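/- Let b > 0. Then the function F : ℝ → ℝ defined by F(κ) := ∫_ℝ 1/(κ + √(κ² + 4b)·cosh x)² dx is strictly decreasing on all of ℝ. (This is the monotonicity, with respect to the Gardner parameter κ, of the leading-order momentum ∫ η̃² of the Gardner soliton η̃ = 2/(κ + √(κ²+4b) cosh x), used to verify d''(c) > 0 for both the elevation and depression branches of the Gardner-type solitary internal waves.) -/

import Mathlib

open MeasureTheory

lemma aux_mono {k : ℝ} : 0 < Real.pi / 2 - Real.arctan k - k / (1 + k ^ 2) := by
  have h1 : 0 < 2 * (Real.pi / 2 - Real.arctan k) := by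
    have := Real.arctan_lt_pi_div_two k
    linarith
  have h2 := Real.sin_lt h1
  rw [Real.sin_two_mul, Real.sin_pi_div_two_sub, Real.cos_pi_div_two_sub, Real.cos_arctan,
    Real.sin_arctan] at h2
  have h3 : 2 * (1 / √(1 + k ^ 2)) * (k / √(1 + k ^ 2)) = 2 * (k / (1 + k ^ 2)) := by
    have : √(1 + k ^ 2) * √(1 + k ^ 2) = 1 + k ^ 2 := Real.mul_self_sqrt (by positivity)
    calc _ = 2 * (k / (√(1 + k ^ 2) * √(1 + k ^ 2))) := by field_simp
      _ = _ := by rw [this]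
  rw [h3] at h2
  linarith

lemma g_mono : StrictMono (fun k : ℝ => k * (Real.pi / 2 - Real.arctan k)) := by
  have hd : ∀ k : ℝ, HasDerivAt (fun k : ℝ => k * (Real.pi / 2 - Real.arctan k))
      (Real.pi / 2 - Real.arctan k - k / (1 + k ^ 2)) k := by
    intro k
    have := (hasDerivAt_id k).mul ((Real.hasDerivAt_arctan k).const_sub (Real.pi / 2))
    refine this.congr_deriv ?_
    simp only [id]
    ring
  apply strictMono_of_deriv_pos
  intro k
  rw [(hd k).deriv]
  exact aux_mono

lemma F_eq (β s κ : ℝ) (hβ : 0 < β) (hs : 0 < s) (h : s ^ 2 = κ ^ 2 + β ^ 2) :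
    ∫ x : ℝ, 1 / (κ + s * Real.cosh x) ^ 2 =
      2 / β ^ 2 * (1 - κ / β * (Real.pi / 2 - Real.arctan (κ / β))) := by
  have hsk : |κ| < s := abs_lt_of_sq_lt_sq (by nlinarith [pow_pos hβ 2]) hs.le
  have hD : ∀ x, 0 < κ + s * Real.cosh x := by
    intro x
    have := Real.one_le_cosh x
    have := (abs_lt.1 hsk).1
    nlinarith
  let G : ℝ → ℝ := fun x => 1 / β ^ 2 *
    (s * Real.sinh x / (κ + s * Real.cosh x) - κ * (2 / β * Real.arctan ((s * Real.exp x + κ) / β)))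
  have hG : ∀ x, HasDerivAt G (1 / (κ + s * Real.cosh x) ^ 2) x := by
    intro x
    have e1 : HasDerivAt (fun x => s * Real.sinh x / (κ + s * Real.cosh x)) _ x :=
      ((Real.hasDerivAt_sinh x).const_mul s).div
        (((Real.hasDerivAt_cosh x).const_mul s).const_add κ) (hD x).ne'
    have e2 : HasDerivAt (fun x => 2 / β * Real.arctan ((s * Real.exp x + κ) / β))
        (1 / (κ + s * Real.cosh x)) x := by
      refine (((((Real.hasDerivAt_exp x).const_mul s).add_const κ).div_const β).arctan.const_mul
        (2 / β)).congr_deriv ?_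
      have hc : s * Real.cosh x = s * (Real.exp x + (Real.exp x)⁻¹) / 2 := by
        rw [Real.cosh_eq, Real.exp_neg]; ring
      have hp := hD x
      have hu := Real.exp_pos x
      rw [hc] at hp ⊢
      generalize Real.exp x = u at *
      have h4 : 0 < 1 + ((s * u + κ) / β) ^ 2 := by positivity
      rw [eq_div_iff hp.ne']
      field_simp
      linear_combination h
    refine ((e1.sub (e2.const_mul κ)).const_mul (1 / β ^ 2)).congr_deriv ?_
    have hp := hD x
    have hcs := Real.cosh_sq x
    generalize Real.cosh x = c at *
    generalize Real.sinh x = d at *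
    field_simp
    linear_combination s ^ 2 * hcs + h
  have hatan : Filter.Tendsto Real.arctan Filter.atTop (nhds (Real.pi / 2)) :=
    Real.tendsto_arctan_atTop.mono_right nhdsWithin_le_nhds
  have htop : Filter.Tendsto G Filter.atTop
      (nhds (1 / β ^ 2 * (1 - κ * (2 / β * (Real.pi / 2))))) := by
    refine Filter.Tendsto.const_mul _ (Filter.Tendsto.sub ?_ ?_)
    · have hc : ContinuousAt (fun v : ℝ => s * (1 - v ^ 2) / (2 * κ * v + s * (1 + v ^ 2))) 0 := by
        refine ContinuousAt.div (by fun_prop) (by fun_prop) ?_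
        simp [hs.ne']
      have h5 := hc.tendsto.comp Real.tendsto_exp_neg_atTop_nhds_zero
      have h6 : s * (1 - (0:ℝ) ^ 2) / (2 * κ * 0 + s * (1 + 0 ^ 2)) = 1 := by
        simp [hs.ne']
      rw [h6] at h5
      refine h5.congr fun x => ?_
      have hp := hD x
      simp only [Function.comp]
      rw [Real.sinh_eq, Real.cosh_eq] at *
      have hu := Real.exp_pos x
      rw [Real.exp_neg] at *
      generalize Real.exp x = u at *
      have : 2 * κ * u⁻¹ + s * (1 + u⁻¹ ^ 2) = 2 * u⁻¹ * (κ + s * ((u + u⁻¹) / 2)) := by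
        field_simp
      rw [this, div_eq_div_iff (by positivity) hp.ne']
      field_simp
    · refine Filter.Tendsto.const_mul _ (Filter.Tendsto.const_mul _ (hatan.comp ?_))
      exact (Filter.tendsto_atTop_add_const_right _ _
        (Real.tendsto_exp_atTop.const_mul_atTop hs)).atTop_div_const hβ
  have hbot : Filter.Tendsto G Filter.atBot
      (nhds (1 / β ^ 2 * (-1 - κ * (2 / β * Real.arctan (κ / β))))) := by
    refine Filter.Tendsto.const_mul _ (Filter.Tendsto.sub ?_ ?_)
    · have hc : ContinuousAt (fun v : ℝ => s * (v ^ 2 - 1) / (2 * κ * v + s * (1 + v ^ 2))) 0 := by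
        refine ContinuousAt.div (by fun_prop) (by fun_prop) ?_
        simp [hs.ne']
      have h5 := hc.tendsto.comp Real.tendsto_exp_atBot
      have h6 : s * ((0:ℝ) ^ 2 - 1) / (2 * κ * 0 + s * (1 + 0 ^ 2)) = -1 := by
        simp [hs.ne']
      rw [h6] at h5
      refine h5.congr fun x => ?_
      have hp := hD x
      simp only [Function.comp]
      rw [Real.sinh_eq, Real.cosh_eq] at *
      have hu := Real.exp_pos x
      rw [Real.exp_neg] at *
      generalize Real.exp x = u at *
      have : 2 * κ * u + s * (1 + u ^ 2) = 2 * u * (κ + s * ((u + u⁻¹) / 2)) := by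
        field_simp
        ring
      rw [this, div_eq_div_iff (by positivity) hp.ne']
      field_simp
    · have hc : Continuous (fun v : ℝ => κ * (2 / β * Real.arctan ((s * v + κ) / β))) := by
        fun_prop
      have h5 := (hc.tendsto 0).comp Real.tendsto_exp_atBot
      simpa [Function.comp_def] using h5
  have hnn : ∀ x, 0 ≤ 1 / (κ + s * Real.cosh x) ^ 2 := fun x => by positivity
  have hi1 : IntegrableOn (fun x => 1 / (κ + s * Real.cosh x) ^ 2) (Set.Ioi 0) :=
    integrableOn_Ioi_deriv_of_nonneg' (fun x _ => hG x) (fun x _ => hnn x) htop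
  have hi2 : IntegrableOn (fun x => 1 / (κ + s * Real.cosh x) ^ 2) (Set.Iic 0) := by
    have h0 := hi1
    rw [← neg_zero (G := ℝ)] at h0
    have := IntegrableOn.comp_neg_Iio (c := (0:ℝ)) h0
    simp only [Real.cosh_neg] at this
    rwa [integrableOn_Iic_iff_integrableOn_Iio]
  have hi : Integrable (fun x => 1 / (κ + s * Real.cosh x) ^ 2) := by
    rw [← integrableOn_univ, ← Set.Iic_union_Ioi (a := (0:ℝ))]
    exact hi2.union hi1
  rw [integral_of_hasDerivAt_of_tendsto hG hi hbot htop]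
  field_simp
  ring

/-- For `b > 0`, the function
`F(κ) := ∫ 1/(κ + √(κ² + 4b) cosh x)² dx` is strictly decreasing on `ℝ`. -/
theorem stmt15 (b : ℝ) (hb : 0 < b) :
    StrictAnti (fun κ : ℝ =>
      ∫ x : ℝ, 1 / (κ + Real.sqrt (κ ^ 2 + 4 * b) * Real.cosh x) ^ 2) := by
  have hβ : 0 < 2 * √b := by positivity
  have hF : ∀ κ : ℝ, _ := fun κ => F_eq (2 * √b) (√(κ ^ 2 + 4 * b)) κ hβ (by positivity) (by
    rw [Real.sq_sqrt (by positivity), mul_pow, Real.sq_sqrt hb.le]; ring)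
  intro x y hxy
  simp only [hF]
  have := g_mono (div_lt_div_of_pos_right hxy hβ)
  simp only at this
  refine mul_lt_mul_of_pos_left ?_ (by positivity)
  linarith
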